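/- Let X be a topological space with pairwise commuting continuous maps φ₁,…,φ_d : X → X and let J ⊆ {1,…,d}. Suppose X contains no nonempty J-wandering open set. Then for every nonempty open set V ⊆ X and every m ∈ ℕ^d there exists n ∈ Σ_J with n_j > m_j for every j ∈ J such that φ_n^{−1}(V) ∩ V ≠ ∅. -/

import Mathlib

open Filter Topology Set

/-- `phiIter φ n = φ₁^[n₁] ∘ ⋯ ∘ φ_d^[n_d]`. -/
def phiIter {X : Type*} {d : ℕ} (φ : Fin d → X → X) (n : Fin d → ℕ) : X → X :=
  (List.ofFn fun j : Fin d => (φ j)^[n j]).foldr (· ∘ ·) id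

theorem phiIter_succ {X : Type*} {d : ℕ} (φ : Fin (d + 1) → X → X) (n : Fin (d + 1) → ℕ) :
    phiIter φ n = (φ 0)^[n 0] ∘ phiIter (fun j => φ j.succ) (fun j => n j.succ) := by
  simp [phiIter, List.ofFn_succ]

theorem continuous_phiIter {X : Type*} [TopologicalSpace X] {d : ℕ} {φ : Fin d → X → X}
    (hcont : ∀ j, Continuous (φ j)) (n : Fin d → ℕ) : Continuous (phiIter φ n) := by
  induction d with
  | zero => simpa [phiIter] using continuous_id
  | succ d ih =>
    rw [phiIter_succ]
    exact ((hcont 0).iterate _).comp (ih (fun j => hcont j.succ) _)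

theorem commute_phiIter {X : Type*} {d : ℕ} {φ : Fin d → X → X} {f : X → X}
    (hf : ∀ j, Function.Commute f (φ j)) (n : Fin d → ℕ) :
    Function.Commute f (phiIter φ n) := by
  induction d with
  | zero => intro x; simp [phiIter]
  | succ d ih =>
    rw [phiIter_succ]
    exact ((hf 0).iterate_right _).comp_right (ih (fun j => hf j.succ) _)

theorem phiIter_add {X : Type*} {d : ℕ} {φ : Fin d → X → X}
    (hcomm : ∀ i j, Function.Commute (φ i) (φ j)) (m n : Fin d → ℕ) (x : X) :
    phiIter φ (m + n) x = phiIter φ m (phiIter φ n x) := by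
  induction d with
  | zero => simp [phiIter]
  | succ d ih =>
    have hc := (commute_phiIter (fun j => hcomm 0 j.succ) (fun j => m j.succ)).iterate_left (n 0)
    have ha := ih (fun i j => hcomm i.succ j.succ) (fun j => m j.succ) (fun j => n j.succ)
    simp only [phiIter_succ, Function.comp_apply, Pi.add_apply, Function.iterate_add_apply]
    rw [← hc.eq, ← ha]
    rfl

/-- If the system has no nonempty `J`-wandering open set, then every nonempty open set
`V` returns to itself under some `φ_n` with `n ∈ Σ_J` whose `J`-coordinates are as
large as desired. -/
theorem exists_large_return_of_no_wandering {X : Type*} [TopologicalSpace X] {d : ℕ}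
    (φ : Fin d → X → X) (hcont : ∀ j, Continuous (φ j))
    (hcomm : ∀ i j, Function.Commute (φ i) (φ j)) (J : Set (Fin d))
    (hnw : ∀ V : Set X, IsOpen V →
      (∀ n : Fin d → ℕ, (∀ j ∈ J, 0 < n j) → phiIter φ n ⁻¹' V ∩ V = ∅) → V = ∅) :
    ∀ V : Set X, IsOpen V → V.Nonempty → ∀ m : Fin d → ℕ,
      ∃ n : Fin d → ℕ, (∀ j ∈ J, 0 < n j) ∧ (∀ j ∈ J, m j < n j) ∧
        (phiIter φ n ⁻¹' V ∩ V).Nonempty := by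
  have hret : ∀ V : Set X, IsOpen V → V.Nonempty →
      ∃ n : Fin d → ℕ, (∀ j ∈ J, 0 < n j) ∧ (phiIter φ n ⁻¹' V ∩ V).Nonempty := by
    intro V hV hne
    by_contra! h
    exact hne.ne_empty (hnw V hV h)
  have hlarge : ∀ (k : ℕ) (V : Set X), IsOpen V → V.Nonempty →
      ∃ n : Fin d → ℕ, (∀ j ∈ J, k < n j) ∧ (phiIter φ n ⁻¹' V ∩ V).Nonempty := by
    intro k V hV hne
    induction k with
    | zero => exact hret V hV hne
    | succ k ih =>
      obtain ⟨n, hn, hW⟩ := ih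
      obtain ⟨n', hn', x, hx, hxW⟩ :=
        hret _ ((hV.preimage (continuous_phiIter hcont n)).inter hV) hW
      refine ⟨n + n', fun j hj => ?_, x, ?_, hxW.2⟩
      · have := hn j hj
        have := hn' j hj
        simp only [Pi.add_apply]
        omega
      · rw [mem_preimage, phiIter_add hcomm]
        exact hx.1
  intro V hV hne m
  obtain ⟨n, hn, h⟩ := hlarge (∑ j, m j) V hV hne
  have hm : ∀ j ∈ J, m j < n j := fun j hj =>
    (Finset.single_le_sum (fun i _ => Nat.zero_le (m i)) (Finset.mem_univ j)).trans_lt (hn j hj)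
  exact ⟨n, fun j hj => (Nat.zero_le _).trans_lt (hm j hj), hm, h⟩
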